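/- arXiv:2401.17848 — 6 statements merged into one kernel-verified Lean document; each statement's English description precedes it below -/
import Mathlib

section
/- Let D be a pretriangulated category equipped with two t-structures t and t' such that every t-connective object is t'-connective (D^t_{≥0} ⊆ D^{t'}_{≥0}) and every object of D^t_{≤0} lies in D^{t'}_{≤1}. Then for every object E of D and every integer n, the canonical morphism τ^t_{≥k}E → E induces an isomorphism π^{t'}_n(τ^t_{≥k}E) ≅ π^{t'}_n(E) for every k ≤ n−1, and the canonical morphism E → τ^t_{≤l}E induces an isomorphism π^{t'}_n(E) ≅ π^{t'}_n(τ^t_{≤l}E) for every l ≥ n. -/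
/-!
STATEMENT 1: With `t`, `t'` two t-structures on a pretriangulated `D` such that
`D^t_{≥0} ⊆ D^{t'}_{≥0}` and `D^t_{≤0} ⊆ D^{t'}_{≤1}`, for every `E` and `n` the canonical
morphism `τ^t_{≥k}E → E` induces an isomorphism on `π^{t'}_n` for `k ≤ n-1`, and
`E → τ^t_{≤l}E` induces an isomorphism on `π^{t'}_n` for `l ≥ n`.  (Truncations are encoded
by their universal truncation triangles.)
-/

open CategoryTheory Category Limits Pretriangulated

universe v u v' u'

namespace Statement1

variable (D : Type u) [Category.{v} D] [Preadditive D] [HasZeroObject D]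
  [HasShift D ℤ] [∀ n : ℤ, (shiftFunctor D n).Additive] [Pretriangulated D]

/-- A t-structure on a pretriangulated category, written in homological indexing:
`GE n` is the class of `n`-connective objects `D_{≥n}` and `LE n` is the class of
`n`-truncated objects `D_{≤n}`. -/
structure HTStructure where
  /-- the `n`-connective objects `D_{≥n}` -/
  GE : ℤ → D → Prop
  /-- the `n`-truncated objects `D_{≤n}` -/
  LE : ℤ → D → Prop
  ge_of_iso : ∀ {X Y : D}, (X ≅ Y) → ∀ n : ℤ, GE n X → GE n Y
  le_of_iso : ∀ {X Y : D}, (X ≅ Y) → ∀ n : ℤ, LE n X → LE n Y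
  ge_shift : ∀ (n k : ℤ) (X : D), GE n X → GE (n + k) (X⟦k⟧)
  le_shift : ∀ (n k : ℤ) (X : D), LE n X → LE (n + k) (X⟦k⟧)
  ge_antitone : ∀ (m n : ℤ) (X : D), m ≤ n → GE n X → GE m X
  le_monotone : ∀ (m n : ℤ) (X : D), m ≤ n → LE m X → LE n X
  hom_zero : ∀ {X Y : D} (f : X ⟶ Y), GE 1 X → LE 0 Y → f = 0
  exists_truncation : ∀ (X : D) (n : ℤ),
    ∃ (A B : D) (f : A ⟶ X) (g : X ⟶ B) (h : B ⟶ A⟦(1 : ℤ)⟧),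
      GE n A ∧ LE (n - 1) B ∧ Triangle.mk f g h ∈ distTriang D

variable {D}

/-- The homology functors `π n` (homological indexing) associated to a t-structure `t`,
valued in an additive category `H` (e.g. the heart of `t`): they take values in the
heart, kill connective/truncated objects in the appropriate range, are compatible with
the shift, and send distinguished triangles to exact sequences. -/
structure THomology (t : HTStructure D) (H : Type u') [Category.{v'} H] [Preadditive H] where
  /-- the `n`-th homology functor of the t-structure -/
  π : ℤ → D ⥤ H
  shiftIso : ∀ (n k : ℤ) (X : D), (π n).obj (X⟦k⟧) ≅ (π (n - k)).obj X
  vanish_ge : ∀ (n k : ℤ) (X : D), t.GE n X → k < n → IsZero ((π k).obj X)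
  vanish_le : ∀ (n k : ℤ) (X : D), t.LE n X → n < k → IsZero ((π k).obj X)
  comp_zero : ∀ (T : Triangle D) (_ : T ∈ distTriang D) (n : ℤ),
      (π n).map T.mor₁ ≫ (π n).map T.mor₂ = 0
  exact₂ : ∀ (T : Triangle D) (hT : T ∈ distTriang D) (n : ℤ),
      (ShortComplex.mk ((π n).map T.mor₁) ((π n).map T.mor₂) (comp_zero T hT n)).Exact

end Statement1

open Statement1

namespace Statement1

variable {D : Type u} [Category.{v} D] [Preadditive D] [HasZeroObject D]
  [HasShift D ℤ] [∀ n : ℤ, (shiftFunctor D n).Additive] [Pretriangulated D]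

namespace HTStructure

lemma ge_of_ge_zero_imp {t t' : HTStructure D} {a : ℤ} (h : ∀ X : D, t.GE 0 X → t'.GE a X)
    (n : ℤ) (X : D) (hX : t.GE n X) : t'.GE (a + n) X := by
  have h₀ := t.ge_shift n (-n) X hX
  rw [add_neg_cancel] at h₀
  exact t'.ge_of_iso ((shiftEquiv' D (-n) n (neg_add_cancel n)).unitIso.app X).symm _
    (t'.ge_shift a n _ (h _ h₀))

lemma le_of_le_zero_imp {t t' : HTStructure D} {a : ℤ} (h : ∀ X : D, t.LE 0 X → t'.LE a X)
    (n : ℤ) (X : D) (hX : t.LE n X) : t'.LE (a + n) X := by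
  have h₀ := t.le_shift n (-n) X hX
  rw [add_neg_cancel] at h₀
  exact t'.le_of_iso ((shiftEquiv' D (-n) n (neg_add_cancel n)).unitIso.app X).symm _
    (t'.le_shift a n _ (h _ h₀))

end HTStructure

namespace THomology

variable {t : HTStructure D} {H : Type u'} [Category.{v'} H] [Abelian H] (π : THomology t H)

lemma isIso_map_mor₁ (T : Triangle D) (hT : T ∈ distTriang D) (n : ℤ)
    (h₃ : IsZero ((π.π n).obj T.obj₃)) (h₃' : IsZero ((π.π (n + 1)).obj T.obj₃)) :
    IsIso ((π.π n).map T.mor₁) := by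
  have hT' := inv_rot_of_distTriang T hT
  have : Mono ((π.π n).map T.mor₁) :=
    (π.exact₂ T.invRotate hT' n).mono_g
      (((h₃'.of_iso (eqToIso (by rw [sub_neg_eq_add]))).of_iso
        (π.shiftIso n (-1) T.obj₃)).eq_of_src _ _)
  have : Epi ((π.π n).map T.mor₁) := (π.exact₂ T hT n).epi_f (h₃.eq_of_tgt _ _)
  exact isIso_of_mono_of_epi _

lemma isIso_map_mor₂ (T : Triangle D) (hT : T ∈ distTriang D) (n : ℤ)
    (h₁ : IsZero ((π.π n).obj T.obj₁)) (h₁' : IsZero ((π.π (n - 1)).obj T.obj₁)) :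
    IsIso ((π.π n).map T.mor₂) := by
  have hT' := rot_of_distTriang T hT
  have : Mono ((π.π n).map T.mor₂) := (π.exact₂ T hT n).mono_g (h₁.eq_of_src _ _)
  have : Epi ((π.π n).map T.mor₂) :=
    (π.exact₂ T.rotate hT' n).epi_f ((h₁'.of_iso (π.shiftIso n 1 T.obj₁)).eq_of_tgt _ _)
  exact isIso_of_mono_of_epi _

end THomology

end Statement1

/-- The canonical morphism `τ^t_{≥k}E → E` (encoded as the first morphism of any
distinguished triangle `A → E → B → A⟦1⟧` with `A ∈ D^t_{≥k}` and `B ∈ D^t_{≤k-1}`)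
induces an isomorphism `π^{t'}_n(τ^t_{≥k}E) ≅ π^{t'}_n(E)` for every `k ≤ n-1`, and the
canonical morphism `E → τ^t_{≤l}E` induces an isomorphism
`π^{t'}_n(E) ≅ π^{t'}_n(τ^t_{≤l}E)` for every `l ≥ n`. -/
theorem statement1
    {D : Type u} [Category.{v} D] [Preadditive D] [HasZeroObject D]
    [HasShift D ℤ] [∀ n : ℤ, (shiftFunctor D n).Additive] [Pretriangulated D]
    (t t' : HTStructure D)
    (hGE : ∀ X : D, t.GE 0 X → t'.GE 0 X)
    (hLE : ∀ X : D, t.LE 0 X → t'.LE 1 X)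
    {H' : Type u'} [Category.{v'} H'] [Abelian H']
    (π' : THomology t' H')
    (E : D) (n : ℤ) :
    (∀ (k : ℤ), k ≤ n - 1 →
      ∀ (A B : D) (f : A ⟶ E) (g : E ⟶ B) (h : B ⟶ A⟦(1 : ℤ)⟧),
        t.GE k A → t.LE (k - 1) B → (Triangle.mk f g h ∈ distTriang D) →
          IsIso ((π'.π n).map f)) ∧
    (∀ (l : ℤ), n ≤ l →
      ∀ (A B : D) (f : A ⟶ E) (g : E ⟶ B) (h : B ⟶ A⟦(1 : ℤ)⟧),
        t.GE (l + 1) A → t.LE l B → (Triangle.mk f g h ∈ distTriang D) →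
          IsIso ((π'.π n).map g)) := by
  refine ⟨fun k hk A B f g h _ hB hT => ?_, fun l hl A B f g h hA _ hT => ?_⟩
  · have hB' := HTStructure.le_of_le_zero_imp hLE _ B hB
    exact π'.isIso_map_mor₁ (Triangle.mk f g h) hT n
      (π'.vanish_le _ _ _ hB' (by lia)) (π'.vanish_le _ _ _ hB' (by lia))
  · have hA' := HTStructure.ge_of_ge_zero_imp hGE _ A hA
    exact π'.isIso_map_mor₂ (Triangle.mk f g h) hT n
      (π'.vanish_ge _ _ _ hA' (by lia)) (π'.vanish_ge _ _ _ hA' (by lia))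
end

section
/- Let D be a pretriangulated category with a t-structure t, let p be a prime and k an integer. Let f : F → E be a morphism in D such that F is k-connective (F ∈ D^t_{≥k}) and f is a p-equivalence, i.e., p·𝟙_C is an isomorphism for a cone C of f (equivalently, f⫽p is an isomorphism). Then π^t_n(E) is uniquely p-divisible for all n < k. -/
/-!
STATEMENT 3: If `f : F → E` is a p-equivalence in a pretriangulated category with
t-structure `t` (i.e. multiplication by `p` is an isomorphism on any cone of `f`)
and `F` is k-connective, then `π^t_n(E)` is uniquely p-divisible for all `n < k`.
-/

open CategoryTheory Category Limits Pretriangulated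

universe v u v' u'

namespace Statement3

variable (D : Type u) [Category.{v} D] [Preadditive D] [HasZeroObject D]
  [HasShift D ℤ] [∀ n : ℤ, (shiftFunctor D n).Additive] [Pretriangulated D]

/-- A t-structure on a pretriangulated category, written in homological indexing:
`GE n` is the class of `n`-connective objects `D_{≥n}` and `LE n` is the class of
`n`-truncated objects `D_{≤n}`. -/
structure HTStructure where
  /-- the `n`-connective objects `D_{≥n}` -/
  GE : ℤ → D → Prop
  /-- the `n`-truncated objects `D_{≤n}` -/
  LE : ℤ → D → Prop
  ge_of_iso : ∀ {X Y : D}, (X ≅ Y) → ∀ n : ℤ, GE n X → GE n Y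
  le_of_iso : ∀ {X Y : D}, (X ≅ Y) → ∀ n : ℤ, LE n X → LE n Y
  ge_shift : ∀ (n k : ℤ) (X : D), GE n X → GE (n + k) (X⟦k⟧)
  le_shift : ∀ (n k : ℤ) (X : D), LE n X → LE (n + k) (X⟦k⟧)
  ge_antitone : ∀ (m n : ℤ) (X : D), m ≤ n → GE n X → GE m X
  le_monotone : ∀ (m n : ℤ) (X : D), m ≤ n → LE m X → LE n X
  hom_zero : ∀ {X Y : D} (f : X ⟶ Y), GE 1 X → LE 0 Y → f = 0
  exists_truncation : ∀ (X : D) (n : ℤ),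
    ∃ (A B : D) (f : A ⟶ X) (g : X ⟶ B) (h : B ⟶ A⟦(1 : ℤ)⟧),
      GE n A ∧ LE (n - 1) B ∧ Triangle.mk f g h ∈ distTriang D

variable {D}

/-- The homology functors `π n` (homological indexing) associated to a t-structure `t`,
valued in an additive category `H` (e.g. the heart of `t`): they take values in the
heart, kill connective/truncated objects in the appropriate range, are compatible with
the shift, and send distinguished triangles to exact sequences. -/
structure THomology (t : HTStructure D) (H : Type u') [Category.{v'} H] [Preadditive H] where
  /-- the `n`-th homology functor of the t-structure -/
  π : ℤ → D ⥤ H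
  shiftIso : ∀ (n k : ℤ) (X : D), (π n).obj (X⟦k⟧) ≅ (π (n - k)).obj X
  vanish_ge : ∀ (n k : ℤ) (X : D), t.GE n X → k < n → IsZero ((π k).obj X)
  vanish_le : ∀ (n k : ℤ) (X : D), t.LE n X → n < k → IsZero ((π k).obj X)
  comp_zero : ∀ (T : Triangle D) (_ : T ∈ distTriang D) (n : ℤ),
      (π n).map T.mor₁ ≫ (π n).map T.mor₂ = 0
  exact₂ : ∀ (T : Triangle D) (hT : T ∈ distTriang D) (n : ℤ),
      (ShortComplex.mk ((π n).map T.mor₁) ((π n).map T.mor₂) (comp_zero T hT n)).Exact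

end Statement3

namespace Statement3

variable {D : Type u} [Category.{v} D] [Preadditive D] [HasZeroObject D]
  [HasShift D ℤ] [∀ n : ℤ, (shiftFunctor D n).Additive] [Pretriangulated D]
  {t : HTStructure D} {H : Type u'} [Category.{v'} H]

open ZeroObject in
theorem THomology.preservesZeroMorphisms [Preadditive H] (π : THomology t H) (n : ℤ) :
    (π.π n).PreservesZeroMorphisms := by
  have hzero : IsZero ((π.π n).obj (0 : D)) := by
    rw [IsZero.iff_id_eq_zero]
    have h : (π.π n).map (𝟙 (0 : D)) ≫ (π.π n).map (0 : (0 : D) ⟶ 0) = 0 :=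
      π.comp_zero _ (contractible_distinguished (0 : D)) n
    rwa [Subsingleton.elim (0 : (0 : D) ⟶ 0) (𝟙 0), CategoryTheory.Functor.map_id,
      id_comp] at h
  refine ⟨fun X Y => ?_⟩
  rw [← zero_comp (X := X) (Y := 0) (f := (0 : (0 : D) ⟶ Y)), Functor.map_comp,
    hzero.eq_of_tgt ((π.π n).map (0 : X ⟶ 0)) 0, zero_comp]

theorem THomology.isHomological [Abelian H] (π : THomology t H) (n : ℤ) :
    (π.π n).IsHomological where
  toPreservesZeroMorphisms := π.preservesZeroMorphisms n
  exact T hT := π.exact₂ T hT n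

theorem THomology.isIso_map_mor₂ [Abelian H] (π : THomology t H) {T : Triangle D}
    (hT : T ∈ distTriang D) {k n : ℤ} (h₁ : t.GE k T.obj₁) (hn : n < k) :
    IsIso ((π.π n).map T.mor₂) := by
  have : Mono ((π.π n).map T.mor₂) :=
    (π.exact₂ T hT n).mono_g ((π.vanish_ge k n _ h₁ hn).eq_of_src _ _)
  have : Epi ((π.π n).map T.mor₂) :=
    (π.exact₂ _ (rot_of_distTriang _ hT) n).epi_f
      ((π.vanish_ge (k + 1) n _ (t.ge_shift k 1 _ h₁) (by lia)).eq_of_tgt _ _)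
  exact isIso_of_mono_of_epi _

theorem isIso_zsmul_id_of_iso [Preadditive H] {X Y : H} (e : X ≅ Y) (m : ℤ)
    [IsIso (m • 𝟙 Y)] : IsIso (m • 𝟙 X) := by
  have h : m • 𝟙 X = e.hom ≫ (m • 𝟙 Y) ≫ e.inv := by simp
  rw [h]
  infer_instance

end Statement3

open Statement3

theorem statement3
    {D : Type u} [Category.{v} D] [Preadditive D] [HasZeroObject D]
    [HasShift D ℤ] [∀ n : ℤ, (shiftFunctor D n).Additive] [Pretriangulated D]
    (t : HTStructure D)
    (p : ℕ) (hp : p.Prime)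
    {H : Type u'} [Category.{v'} H] [Abelian H]
    (π : THomology t H)
    (k : ℤ) {F E : D} (f : F ⟶ E)
    -- `F` is k-connective
    (hF : t.GE k F)
    -- `f` is a p-equivalence: `p • 𝟙 C` is an isomorphism for any cone `C` of `f`
    (hpe : ∀ (C : D) (g : E ⟶ C) (h : C ⟶ F⟦(1 : ℤ)⟧),
      (Triangle.mk f g h ∈ distTriang D) → IsIso ((p : ℤ) • 𝟙 C))
    (n : ℤ) (hn : n < k) :
    IsIso ((p : ℤ) • 𝟙 ((π.π n).obj E)) := by
  obtain ⟨C, g, h, hT⟩ := distinguished_cocone_triangle f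
  have := hpe C g h hT
  have := π.isHomological n
  have := π.isIso_map_mor₂ hT hF hn
  have : IsIso ((p : ℤ) • 𝟙 ((π.π n).obj C)) := by
    rw [← CategoryTheory.Functor.map_id, ← Functor.map_zsmul]
    infer_instance
  exact isIso_zsmul_id_of_iso (@asIso _ _ _ _ ((π.π n).map g) ‹_›) p
end

section
/- Let D and E be pretriangulated categories with t-structures t_D and t_E, and let F : D → E be a triangulated (exact) functor such that F(A) lies in the heart of t_E for every object A of the heart of t_D. Then F is t-exact on bounded objects: for all integers a ≤ b and every object X of D with X ∈ D^{t_D}_{≥a} ∩ D^{t_D}_{≤b}, one has FX ∈ E^{t_E}_{≥a} ∩ E^{t_E}_{≤b}. -/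
/-!
STATEMENT 7: Let `F : D ⥤ E` be a triangulated functor between pretriangulated
categories with t-structures `tD`, `tE`, sending the heart of `tD` into the heart of
`tE`.  Then `F` is t-exact on bounded objects: for `a ≤ b` and
`X ∈ D^{tD}_{≥a} ∩ D^{tD}_{≤b}` one has `FX ∈ E^{tE}_{≥a} ∩ E^{tE}_{≤b}`.
-/

open CategoryTheory Category Limits Pretriangulated

universe v u v' u'

namespace Statement7

variable (D : Type u) [Category.{v} D] [Preadditive D] [HasZeroObject D]
  [HasShift D ℤ] [∀ n : ℤ, (shiftFunctor D n).Additive] [Pretriangulated D]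

/-- A t-structure on a pretriangulated category, written in homological indexing:
`GE n` is the class of `n`-connective objects `D_{≥n}` and `LE n` is the class of
`n`-truncated objects `D_{≤n}`. -/
structure HTStructure where
  /-- the `n`-connective objects `D_{≥n}` -/
  GE : ℤ → D → Prop
  /-- the `n`-truncated objects `D_{≤n}` -/
  LE : ℤ → D → Prop
  ge_of_iso : ∀ {X Y : D}, (X ≅ Y) → ∀ n : ℤ, GE n X → GE n Y
  le_of_iso : ∀ {X Y : D}, (X ≅ Y) → ∀ n : ℤ, LE n X → LE n Y
  ge_shift : ∀ (n k : ℤ) (X : D), GE n X → GE (n + k) (X⟦k⟧)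
  le_shift : ∀ (n k : ℤ) (X : D), LE n X → LE (n + k) (X⟦k⟧)
  ge_antitone : ∀ (m n : ℤ) (X : D), m ≤ n → GE n X → GE m X
  le_monotone : ∀ (m n : ℤ) (X : D), m ≤ n → LE m X → LE n X
  hom_zero : ∀ {X Y : D} (f : X ⟶ Y), GE 1 X → LE 0 Y → f = 0
  exists_truncation : ∀ (X : D) (n : ℤ),
    ∃ (A B : D) (f : A ⟶ X) (g : X ⟶ B) (h : B ⟶ A⟦(1 : ℤ)⟧),
      GE n A ∧ LE (n - 1) B ∧ Triangle.mk f g h ∈ distTriang D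

variable {D}

end Statement7

open Statement7

universe v₂ u₂

open Triangulated

namespace Statement7.HTStructure

variable {D : Type u} [Category.{v} D] [Preadditive D] [HasZeroObject D]
  [HasShift D ℤ] [∀ n : ℤ, (shiftFunctor D n).Additive] [Pretriangulated D]

/-- The t-structure in cohomological indexing attached to a t-structure in homological
indexing. -/
def toTStructure (t : HTStructure D) : TStructure D where
  le n := t.GE (-n)
  ge n := t.LE (-n)
  le_isClosedUnderIsomorphisms _ := ⟨fun e hX ↦ t.ge_of_iso e _ hX⟩
  ge_isClosedUnderIsomorphisms _ := ⟨fun e hX ↦ t.le_of_iso e _ hX⟩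
  le_shift n a n' h X hX := by
    obtain rfl : n = a + n' := h.symm
    simpa using t.ge_shift _ a X hX
  ge_shift n a n' h X hX := by
    obtain rfl : n = a + n' := h.symm
    simpa using t.le_shift _ a X hX
  zero' X Y f hX hY := by
    apply (shiftFunctor D (1 : ℤ)).map_injective
    rw [Functor.map_zero]
    exact t.hom_zero _ (by simpa using t.ge_shift _ 1 X hX) (by simpa using t.le_shift _ 1 Y hY)
  le_zero_le X hX := t.ge_antitone _ _ X (by simp) hX
  ge_one_le X hX := t.le_monotone _ _ X (by simp) hX
  exists_triangle_zero_one A := by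
    obtain ⟨X, Y, f, g, h, hX, hY, hT⟩ := t.exists_truncation A 0
    exact ⟨X, Y, by simpa using hX, by simpa using hY, f, g, h, hT⟩

lemma isLE_toTStructure_iff (t : HTStructure D) (X : D) (n : ℤ) :
    t.toTStructure.IsLE X n ↔ t.GE (-n) X :=
  (t.toTStructure.le_iff_isLE X n).symm

lemma isGE_toTStructure_iff (t : HTStructure D) (X : D) (n : ℤ) :
    t.toTStructure.IsGE X n ↔ t.LE (-n) X :=
  (t.toTStructure.ge_iff_isGE X n).symm

end Statement7.HTStructure

namespace CategoryTheory.Triangulated.TStructure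

variable {D : Type u} [Category.{v} D] [Preadditive D] [HasZeroObject D]
  [HasShift D ℤ] [∀ n : ℤ, (shiftFunctor D n).Additive] [Pretriangulated D]
  {E : Type u'} [Category.{v'} E] [Preadditive E] [HasZeroObject E]
  [HasShift E ℤ] [∀ n : ℤ, (shiftFunctor E n).Additive] [Pretriangulated E]

/-- A bounded object of amplitude `[p, n₁]` is an extension of an object of amplitude
`[n₁, n₁]` by an object of amplitude `[p, n₀]`, where `n₀ + 1 = n₁`. -/
lemma exists_triangle_of_isGE_of_isLE (t : TStructure D) (X : D) (p n₀ n₁ : ℤ)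
    (h : n₀ + 1 = n₁) (hp : p ≤ n₁) [t.IsGE X p] [t.IsLE X n₁] :
    ∃ T ∈ distTriang D, T.obj₂ = X ∧ t.IsGE T.obj₁ p ∧ t.IsLE T.obj₁ n₀ ∧
      t.IsGE T.obj₃ n₁ ∧ t.IsLE T.obj₃ n₁ := by
  obtain ⟨A, B, hA, hB, f, g, k, hT⟩ := t.exists_triangle X n₀ n₁ h
  have : t.IsLE A n₀ := ⟨hA⟩
  have : t.IsGE B n₁ := ⟨hB⟩
  refine ⟨_, hT, rfl, ?_, ‹_›, ‹_›, ?_⟩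
  · exact t.isGE₂ _ (inv_rot_of_distTriang _ hT) p
      ((t.isGE_shift_iff B (p - 1) (-1) p).2 (t.isGE_of_ge B (p - 1) n₁)) ‹_›
  · exact t.isLE₂ _ (rot_of_distTriang _ hT) n₁ ‹_›
      ((t.isLE_shift_iff A (n₁ + 1) 1 n₁).2 (t.isLE_of_le A n₀ (n₁ + 1)))

variable (tD : TStructure D) (tE : TStructure E) (F : D ⥤ E) [F.CommShift ℤ]

/-- A functor commuting with shifts which preserves the hearts preserves the shifts of
the hearts. -/
lemma isGE_and_isLE_map_of_preserves_heart
    (hF : ∀ A : D, tD.IsGE A 0 → tD.IsLE A 0 → tE.IsGE (F.obj A) 0 ∧ tE.IsLE (F.obj A) 0)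
    (X : D) (p : ℤ) [tD.IsGE X p] [tD.IsLE X p] :
    tE.IsGE (F.obj X) p ∧ tE.IsLE (F.obj X) p := by
  obtain ⟨h₁, h₂⟩ := hF (X⟦p⟧) (tD.isGE_shift X p p 0) (tD.isLE_shift X p p 0)
  have e : F.obj (X⟦p⟧) ≅ (F.obj X)⟦p⟧ := (F.commShiftIso p).app X
  have := tE.isGE_of_iso e 0
  have := tE.isLE_of_iso e 0
  exact ⟨tE.isGE_of_shift (F.obj X) p p 0, tE.isLE_of_shift (F.obj X) p p 0⟩

/-- A triangulated functor which preserves the hearts is t-exact on bounded objects. -/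
lemma isGE_and_isLE_map_of_isTriangulated [F.IsTriangulated]
    (hF : ∀ A : D, tD.IsGE A 0 → tD.IsLE A 0 → tE.IsGE (F.obj A) 0 ∧ tE.IsLE (F.obj A) 0)
    (n : ℕ) (X : D) (p q : ℤ) (hq : p + n = q) [tD.IsGE X p] [tD.IsLE X q] :
    tE.IsGE (F.obj X) p ∧ tE.IsLE (F.obj X) q := by
  induction n generalizing X q with
  | zero =>
    obtain rfl : p = q := by simpa using hq
    exact isGE_and_isLE_map_of_preserves_heart tD tE F hF X p
  | succ n ih =>
    obtain ⟨T, hT, rfl, _, _, _, _⟩ :=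
      tD.exists_triangle_of_isGE_of_isLE X p (p + n) q (by lia) (by lia)
    obtain ⟨h₁, h₁'⟩ := ih T.obj₁ (p + n) rfl
    obtain ⟨h₃, h₃'⟩ := isGE_and_isLE_map_of_preserves_heart tD tE F hF T.obj₃ q
    have hFT := F.map_distinguished T hT
    exact ⟨tE.isGE₂ _ hFT p h₁ (tE.isGE_of_ge (F.obj T.obj₃) p q),
      tE.isLE₂ _ hFT q (tE.isLE_of_le (F.obj T.obj₁) (p + n) q) h₃'⟩

end CategoryTheory.Triangulated.TStructure

theorem statement7
    {D : Type u} [Category.{v} D] [Preadditive D] [HasZeroObject D]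
    [HasShift D ℤ] [∀ n : ℤ, (shiftFunctor D n).Additive] [Pretriangulated D]
    {E : Type u₂} [Category.{v₂} E] [Preadditive E] [HasZeroObject E]
    [HasShift E ℤ] [∀ n : ℤ, (shiftFunctor E n).Additive] [Pretriangulated E]
    (tD : HTStructure D) (tE : HTStructure E)
    (F : D ⥤ E) [F.CommShift ℤ] [F.IsTriangulated]
    -- `F` sends the heart of `tD` into the heart of `tE`
    (hheart : ∀ A : D, tD.GE 0 A → tD.LE 0 A → tE.GE 0 (F.obj A) ∧ tE.LE 0 (F.obj A))
    (a b : ℤ) (hab : a ≤ b)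
    (X : D) (hXa : tD.GE a X) (hXb : tD.LE b X) :
    tE.GE a (F.obj X) ∧ tE.LE b (F.obj X) := by
  obtain ⟨n, hn⟩ := Int.le.dest hab
  have : tD.toTStructure.IsGE X (-b) := by simpa [tD.isGE_toTStructure_iff] using hXb
  have : tD.toTStructure.IsLE X (-a) := by simpa [tD.isLE_toTStructure_iff] using hXa
  have hF (A : D) (hA : tD.toTStructure.IsGE A 0) (hA' : tD.toTStructure.IsLE A 0) :
      tE.toTStructure.IsGE (F.obj A) 0 ∧ tE.toTStructure.IsLE (F.obj A) 0 := by
    simp only [HTStructure.isGE_toTStructure_iff, HTStructure.isLE_toTStructure_iff,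
      neg_zero] at hA hA' ⊢
    exact (hheart A hA' hA).symm
  simpa [HTStructure.isGE_toTStructure_iff, HTStructure.isLE_toTStructure_iff, and_comm] using
    TStructure.isGE_and_isLE_map_of_isTriangulated tD.toTStructure tE.toTStructure F hF n X
      (-b) (-a) (by lia)
end

section
/- Let (C, J) be a small site and R a nontrivial ring. Then the free R-module sheaf functor R[-] : Sh(C, J; Set) → Sh(C, J; Mod_R), left adjoint to the forgetful functor, is conservative: if f is a morphism of sheaves of sets such that R[f] is an isomorphism of sheaves of R-modules, then f is an isomorphism. -/
open CategoryTheory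

universe u

namespace ModuleCat

variable {R : Type u} [Ring R] [Nontrivial R]

lemma freeMk_injective {S : Type u} : Function.Injective (freeMk (R := R) (X := S)) :=
  Finsupp.single_left_injective one_ne_zero

lemma mem_range_of_free_map_eq_freeMk {S T : Type u} (g : S ⟶ T) (a : (free R).obj S) (y : T)
    (h : (free R).map g a = freeMk y) : ∃ x, g x = y := by
  classical
  have h' : Finsupp.mapDomain (g : S → T) (a : S →₀ R) = Finsupp.single y 1 := h
  have hy : y ∈ (Finsupp.mapDomain (g : S → T) (a : S →₀ R)).support := by
    simp [h']
  obtain ⟨x, -, hx⟩ := Finset.mem_image.1 (Finsupp.mapDomain_support hy)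
  exact ⟨x, hx⟩

end ModuleCat

namespace CategoryTheory.Presheaf

open ModuleCat

variable {C : Type u} [SmallCategory C] (J : GrothendieckTopology C)
  (R : Type u) [Ring R] [Nontrivial R] {P Q : Cᵒᵖ ⥤ Type u} (f : P ⟶ Q)

lemma isLocallyInjective_of_whiskerRight_free
    [IsLocallyInjective J (Functor.whiskerRight f (free R))] : IsLocallyInjective J f where
  equalizerSieve_mem {U} x y h := by
    have h' : (Functor.whiskerRight f (free R)).app U (freeMk x) =
        (Functor.whiskerRight f (free R)).app U (freeMk y) := by
      simp only [Functor.whiskerRight_app]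
      erw [free_map_apply, free_map_apply, h]
    refine J.superset_covering ?_
      (equalizerSieve_mem J (Functor.whiskerRight f (free R)) _ _ h')
    intro V g hg
    replace hg : (free R).map (P.map g.op) (freeMk x) =
      (free R).map (P.map g.op) (freeMk y) := hg
    rw [free_map_apply, free_map_apply] at hg
    exact freeMk_injective hg

lemma isLocallySurjective_of_whiskerRight_free
    [IsLocallySurjective J (Functor.whiskerRight f (free R))] : IsLocallySurjective J f where
  imageSieve_mem {U} s := by
    refine J.superset_covering ?_
      (imageSieve_mem J (Functor.whiskerRight f (free R)) (U := .op U) (freeMk s))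
    rintro V g ⟨a, ha⟩
    replace ha : (free R).map (f.app (.op V)) a = (free R).map (Q.map g.op) (freeMk s) := ha
    rw [free_map_apply] at ha
    exact mem_range_of_free_map_eq_freeMk _ _ _ ha

end CategoryTheory.Presheaf

theorem statement9
    {C : Type u} [SmallCategory C] (J : GrothendieckTopology C)
    (R : Type u) [Ring R] [Nontrivial R]
    {X Y : Sheaf J (Type u)} (f : X ⟶ Y)
    (hf : IsIso ((Sheaf.composeAndSheafify J (ModuleCat.free R)).map f)) :
    IsIso f := by
  have hW : J.W (Functor.whiskerRight f.hom (ModuleCat.free R)) := (J.W_iff _).2 hf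
  have := hW.isLocallyInjective
  have := hW.isLocallySurjective
  exact (Sheaf.isLocallyBijective_iff_isIso f).1
    ⟨Presheaf.isLocallyInjective_of_whiskerRight_free J R f.hom,
      Presheaf.isLocallySurjective_of_whiskerRight_free J R f.hom⟩
end

section
/- Let (C, J) be a small site and R a nontrivial ring. For every sheaf of sets X on (C, J), the unit morphism X → ι(R[X]) of the adjunction R[-] ⊣ ι is a monomorphism in the category of sheaves of sets on (C, J). -/
/-!
STATEMENT 10: For a small site `(C, J)`, a nontrivial ring `R` and a sheaf of sets `X`
on `(C, J)`, the unit morphism `X → ι(R[X])` of the adjunction `R[-] ⊣ ι` between the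
free `R`-module sheaf functor and the forgetful functor is a monomorphism in the
category of sheaves of sets.
-/

open CategoryTheory

universe u

/-- The unit of the free-forgetful adjunction for modules over a nontrivial ring is injective. -/
lemma ModuleCat.adj_unit_app_injective (R : Type u) [Ring R] [Nontrivial R] (S : Type u) :
    Function.Injective ((ModuleCat.adj R).unit.app S) :=
  Finsupp.single_left_injective (one_ne_zero (α := R))

theorem statement10
    {C : Type u} [SmallCategory C] (J : GrothendieckTopology C)
    (R : Type u) [Ring R] [Nontrivial R]
    (X : Sheaf J (Type u)) :
    Mono ((Sheaf.adjunction J (ModuleCat.adj R)).unit.app X) := by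
  have : Presheaf.IsLocallyInjective J
      (((ModuleCat.adj R).whiskerRight Cᵒᵖ).unit.app X.obj) :=
    Presheaf.isLocallyInjective_of_injective J _ fun U => by
      simpa using ModuleCat.adj_unit_app_injective R (X.obj.obj U)
  have : Sheaf.IsLocallyInjective ((Sheaf.adjunction J (ModuleCat.adj R)).unit.app X) := by
    rw [Sheaf.IsLocallyInjective, Sheaf.adjunction_unit_app_hom]
    have : Presheaf.IsLocallyInjective J (toSheafify J (X.obj ⋙ ModuleCat.free R)) :=
      Presheaf.isLocallyInjective_toSheafify' J _
    exact @Presheaf.isLocallyInjective_comp _ _ _ _ _ _ _ _ J _ _ _ _ _ ‹_›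
      (Presheaf.isLocallyInjective_forget J _)
  exact Sheaf.mono_of_isLocallyInjective _
end

section
/- Let p be a prime and A an abelian group, and let T be the inverse limit of the tower ⋯ → A[p^{n+1}] → A[p^n] → ⋯ whose transition maps are multiplication by p; concretely, T = {(a_n)_{n ≥ 0} ∈ ∏_n A : p^n · a_n = 0 and p · a_{n+1} = a_n for all n}. Then T has bounded p-divisibility: for every abelian group B on which multiplication by p is surjective (B is p-divisible), the only group homomorphism B → T is the zero homomorphism. -/
/-!
STATEMENT 13: Let `p` be a prime, `A` an abelian group, and `T` the inverse limit of the
tower `⋯ → A[p^{n+1}] → A[p^n] → ⋯` with multiplication-by-`p` transition maps, realized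
as the subgroup `T = {(a_n) ∈ ∏ₙ A : p^n • a_n = 0 and p • a_{n+1} = a_n}` of `ℕ → A`.
Then `T` has bounded p-divisibility: every homomorphism from a p-divisible abelian group
`B` to `T` is zero.
-/

theorem statement13 (p : ℕ) (hp : p.Prime)
    (A : Type*) [AddCommGroup A]
    (T : AddSubgroup (ℕ → A))
    (hT : ∀ x : ℕ → A, x ∈ T ↔ ((∀ n : ℕ, p ^ n • x n = 0) ∧ ∀ n : ℕ, p • x (n + 1) = x n))
    (B : Type*) [AddCommGroup B]
    -- `B` is p-divisible: multiplication by `p` is surjective on `B`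
    (hB : ∀ b : B, ∃ c : B, p • c = b)
    (f : B →+ T) :
    f = 0 := by
  have hdiv : ∀ (n : ℕ) (b : B), ∃ c : B, p ^ n • c = b := by
    intro n
    induction n with
    | zero => exact fun b => ⟨b, by simp⟩
    | succ k ih =>
      intro b
      obtain ⟨c, rfl⟩ := ih b
      obtain ⟨d, rfl⟩ := hB c
      exact ⟨d, by rw [pow_succ, mul_smul]⟩
  ext b n
  obtain ⟨c, rfl⟩ := hdiv n b
  simpa using ((hT _).1 (f c).2).1 n
end
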